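/- For every sufficiently large n ∈ 16ℕ: the Fourier coefficient û_{0,n}(ξ) vanishes for every ξ ∈ ℤ with | |ξ| − 2^n | ≥ 2^{n/2+1}; consequently Δ_j u_{0,n} = 0 for every integer j ≥ −1 with j ∉ {n−1, n, n+1}. -/

import Mathlib

open MeasureTheory Filter Function
open scoped ENNReal NNReal

noncomputable section

/-- The Fourier coefficient `û(ξ) = ∫_{-π}^{π} e^{-i x ξ} u(x) dx` of a `2π`-periodic
function on the torus. -/
def fCoeff (u : ℝ → ℂ) (ξ : ℤ) : ℂ :=
  ∫ x in (-Real.pi)..Real.pi, Complex.exp (-Complex.I * x * ξ) * u x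

/-- A Littlewood–Paley cutoff function: smooth, even, `0 ≤ χ ≤ 1`, `χ = 1` on `[-3/4,3/4]`,
`supp χ ⊆ (-4/3, 4/3)`, nonincreasing on `[0,∞)`. -/
structure LPCutoff where
  χ : ℝ → ℝ
  smooth : ContDiff ℝ (⊤ : ℕ∞) χ
  even : ∀ x, χ (-x) = χ x
  nonneg : ∀ x, 0 ≤ χ x
  le_one : ∀ x, χ x ≤ 1
  eq_one : ∀ x ∈ Set.Icc (-(3/4) : ℝ) (3/4 : ℝ), χ x = 1
  supp : ∀ x, χ x ≠ 0 → x ∈ Set.Ioo (-(4/3) : ℝ) (4/3 : ℝ)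
  decay : AntitoneOn χ (Set.Ici 0)

/-- `φ(ξ) = χ(ξ/2) - χ(ξ)`. -/
def LPCutoff.phi (c : LPCutoff) (x : ℝ) : ℝ := c.χ (x / 2) - c.χ x

/-- The dyadic block `Δ_j u` (for `j ≥ -1`). -/
def LPblock (c : LPCutoff) (j : ℤ) (u : ℝ → ℂ) (x : ℝ) : ℂ :=
  if j = -1 then
    (1 / (2 * Real.pi)) * ∑' ξ : ℤ, (c.χ ξ : ℂ) * fCoeff u ξ * Complex.exp (Complex.I * x * ξ)
  else
    (1 / (2 * Real.pi)) *
      ∑' ξ : ℤ, (c.phi ((2:ℝ) ^ (-j) * ξ) : ℂ) * fCoeff u ξ * Complex.exp (Complex.I * x * ξ)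

/-- The low-frequency cut-off `S_j u`. -/
def LPlow (c : LPCutoff) (j : ℤ) (u : ℝ → ℂ) (x : ℝ) : ℂ :=
  (1 / (2 * Real.pi)) *
    ∑' ξ : ℤ, (c.χ ((2:ℝ) ^ (-j) * ξ) : ℂ) * fCoeff u ξ * Complex.exp (Complex.I * x * ξ)

/-- The `L^∞(𝕋)` (sup) norm, with values in `ℝ≥0∞`. -/
def supNormE {E : Type*} [NormedAddCommGroup E] (f : ℝ → E) : ℝ≥0∞ :=
  ⨆ x : ℝ, (‖f x‖₊ : ℝ≥0∞)

/-- View a real-valued function as a complex-valued one. -/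
def toC (f : ℝ → ℝ) : ℝ → ℂ := fun x => (f x : ℂ)

/-- The `2π`-periodic square wave: `1/2` on `(0,π)`, `-1/2` on `(-π,0)`, `0` on `{-π,0,π}`. -/
def hFun (x : ℝ) : ℝ :=
  let y := x - 2 * Real.pi * ⌊(x + Real.pi) / (2 * Real.pi)⌋
  if y = 0 ∨ y = -Real.pi then 0 else if 0 < y then 1/2 else -1/2

/-- The low-frequency part `f_n = S_{n/2} h` (real-valued). -/
def fLow (c : LPCutoff) (n : ℕ) : ℝ → ℝ := fun x => (LPlow c ((n : ℤ) / 2) (toC hFun) x).re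

/-- The initial data `u_{0,n}` for the periodic Camassa–Holm equation. -/
def u0CH (c : LPCutoff) (n : ℕ) : ℝ → ℝ := fun x =>
  (2:ℝ) ^ (-(n:ℤ)) * (n:ℝ) ^ (-(2:ℝ)/5) * Real.log n * Real.cos ((2:ℝ) ^ (n:ℕ) * x) *
    (1 + (n:ℝ) ^ (-(1:ℝ)/5) * fLow c n x)

def PP (ξ : ℤ) (u : ℝ → ℂ) : Prop := Continuous u ∧ fCoeff u ξ = 0

theorem PP_add {ξ : ℤ} {u v : ℝ → ℂ} (hu : PP ξ u) (hv : PP ξ v) :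
    PP ξ (fun x => u x + v x) := by
  obtain ⟨hu, hu'⟩ := hu
  obtain ⟨hv, hv'⟩ := hv
  refine ⟨hu.add hv, ?_⟩
  unfold fCoeff at *
  simp only [mul_add]
  rw [intervalIntegral.integral_add, hu', hv', add_zero]
  · exact Continuous.intervalIntegrable (by fun_prop) _ _
  · exact Continuous.intervalIntegrable (by fun_prop) _ _

theorem PP_smul {ξ : ℤ} {u : ℝ → ℂ} (a : ℂ) (hu : PP ξ u) :
    PP ξ (fun x => a * u x) := by
  obtain ⟨hu, hu'⟩ := hu
  refine ⟨by fun_prop, ?_⟩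
  unfold fCoeff at *
  simp only [mul_left_comm _ a]
  rw [intervalIntegral.integral_const_mul, hu', mul_zero]

theorem PP_sum {ξ : ℤ} (s : Finset ℤ) (u : ℤ → ℝ → ℂ) (hu : ∀ k ∈ s, PP ξ (u k)) :
    PP ξ (fun x => ∑ k ∈ s, u k x) := by
  classical
  induction s using Finset.induction_on with
  | empty => exact ⟨by simp only [Finset.sum_empty]; fun_prop, by simp [fCoeff]⟩
  | insert a s ha ih =>
    simp only [Finset.sum_insert ha]
    exact PP_add (hu a (by simp)) (ih fun k hk => hu k (by simp [hk]))

theorem PP_exp {ξ k : ℤ} (h : k ≠ ξ) :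
    PP ξ (fun x => Complex.exp (Complex.I * x * k)) := by
  refine ⟨by fun_prop, ?_⟩
  unfold fCoeff
  have hc : (Complex.I * ((k:ℂ) - ξ)) ≠ 0 :=
    mul_ne_zero Complex.I_ne_zero (sub_ne_zero.2 (by exact_mod_cast h))
  have : ∀ x : ℝ, Complex.exp (-Complex.I * x * ξ) * Complex.exp (Complex.I * x * k)
      = Complex.exp ((Complex.I * ((k:ℂ) - ξ)) * x) := by
    intro x
    rw [← Complex.exp_add]; congr 1; ring
  simp only [this]
  rw [integral_exp_mul_complex hc, div_eq_zero_iff]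
  left
  rw [sub_eq_zero, Complex.exp_eq_exp_iff_exists_int]
  refine ⟨k - ξ, ?_⟩
  push_cast
  ring

theorem PP_cos {ξ k N : ℤ} (h1 : k + N ≠ ξ) (h2 : k - N ≠ ξ) :
    PP ξ (fun x => Complex.cos (N * x) * Complex.exp (Complex.I * x * k)) := by
  have := PP_smul (1/2) (PP_add (PP_exp h1) (PP_exp h2))
  convert this using 2 with x
  rw [Complex.cos]
  have e1 : Complex.I * x * ((k + N : ℤ):ℂ) = N * x * Complex.I + Complex.I * x * k := by
    push_cast; ring
  have e2 : Complex.I * x * ((k - N : ℤ):ℂ) = - (N * x) * Complex.I + Complex.I * x * k := by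
    push_cast; ring
  rw [e1, e2, Complex.exp_add, Complex.exp_add]
  ring

theorem chi_zero (c : LPCutoff) {x : ℝ} (h : 4/3 ≤ |x|) : c.χ x = 0 := by
  by_contra h0
  have := c.supp x h0
  have : |x| < 4/3 := abs_lt.2 ⟨by linarith [this.1], this.2⟩
  linarith

theorem phi_zero_high (c : LPCutoff) {x : ℝ} (h : 8/3 ≤ |x|) : c.phi x = 0 := by
  unfold LPCutoff.phi
  rw [chi_zero c (x := x) (by linarith), chi_zero c, sub_zero]
  rw [abs_div, abs_two]; linarith

theorem phi_zero_low (c : LPCutoff) {x : ℝ} (h : |x| ≤ 3/4) : c.phi x = 0 := by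
  unfold LPCutoff.phi
  obtain ⟨h1, h2⟩ := abs_le.1 h
  rw [c.eq_one x ⟨by linarith, by linarith⟩, c.eq_one (x/2) ⟨by linarith, by linarith⟩, sub_self]

theorem fLow_eq (c : LPCutoff) (m : ℕ) : ∃ β : ℤ → ℂ, ∀ x : ℝ,
    (fLow c (2 * m) x : ℂ) = ∑ k ∈ Finset.Ioo (-(2:ℤ)^(m+1)) (2^(m+1)),
      (β k * Complex.exp (Complex.I * x * k)
        + (starRingEnd ℂ) (β k) * Complex.exp (Complex.I * x * (-k : ℤ))) := by
  refine ⟨fun k => (1/2) * ((1 / (2 * Real.pi)) *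
    ((c.χ ((2:ℝ) ^ (-(m:ℤ)) * k) : ℂ) * fCoeff (toC hFun) k)), fun x => ?_⟩
  unfold fLow LPlow
  have : (((2 * m : ℕ) : ℤ) / 2) = m := by push_cast; omega
  rw [this, tsum_eq_sum (s := Finset.Ioo (-(2:ℤ)^(m+1)) (2^(m+1)))]
  · rw [Complex.re_eq_add_conj, Finset.mul_sum, map_sum, ← Finset.sum_add_distrib, Finset.sum_div]
    refine Finset.sum_congr rfl fun k _ => ?_
    simp only [map_mul, ← Complex.exp_conj, Complex.conj_I, Complex.conj_ofReal, map_intCast,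
      map_div₀, map_one, map_ofNat]
    have : Complex.I * x * ((-k : ℤ) : ℂ) = - Complex.I * x * k := by push_cast; ring
    rw [this]
    ring
  · intro k hk
    have hk' : (2:ℤ)^(m+1) ≤ |k| := by
      by_contra hlt
      push Not at hlt
      exact hk (Finset.mem_Ioo.2 (abs_lt.1 hlt))
    have hk2 : (2:ℝ)^(m+1) ≤ |(k:ℝ)| := by exact_mod_cast hk'
    rw [chi_zero c]
    · simp
    · rw [abs_mul, abs_of_pos (by positivity), zpow_neg, zpow_natCast, inv_mul_eq_div,
        le_div_iff₀ (by positivity)]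
      rw [pow_succ] at hk2
      have : (0:ℝ) < 2^m := by positivity
      linarith

theorem coeff_zero (c : LPCutoff) (m : ℕ) (ξ : ℤ)
    (h : (2:ℤ) ^ (m + 1) ≤ |(|ξ| - 2 ^ (2*m))|) : fCoeff (toC (u0CH c (2*m))) ξ = 0 := by
  obtain ⟨β, hβ⟩ := fLow_eq c m
  have hN : (0:ℤ) < 2^(2*m) := by positivity
  have hM : (0:ℤ) < 2^(m+1) := by positivity
  have key : ∀ k : ℤ, |k| < 2^(m+1) →
      PP ξ (fun x => Complex.cos (((2^(2*m) : ℤ):ℂ) * x) * Complex.exp (Complex.I * x * k)) := by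
    intro k hk
    generalize (2:ℤ)^(2*m) = N at *
    generalize (2:ℤ)^(m+1) = M at *
    apply PP_cos <;> grind
  have h0 := key 0 (by simp)
  set A : ℝ := (2:ℝ) ^ (-((2*m : ℕ):ℤ)) * ((2*m : ℕ):ℝ) ^ (-(2:ℝ)/5) * Real.log ((2*m : ℕ):ℝ) with hA
  set B : ℝ := ((2*m : ℕ):ℝ) ^ (-(1:ℝ)/5) with hB
  have hs := PP_sum (ξ := ξ) (Finset.Ioo (-(2:ℤ)^(m+1)) (2^(m+1))) _ (fun k hk => by
    have hk' := abs_lt.2 (Finset.mem_Ioo.1 hk)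
    exact PP_add (PP_smul (β k) (key k hk'))
      (PP_smul ((starRingEnd ℂ) (β k)) (key (-k) (by rwa [abs_neg]))))
  have tot := PP_smul A (PP_add h0 (PP_smul B hs))
  convert tot.2 using 2
  funext x
  unfold toC u0CH
  rw [← hA, ← hB]
  push_cast
  rw [hβ x]
  simp only [Int.cast_zero, mul_zero, Complex.exp_zero, mul_one]
  have : ∀ S : ℂ, (A:ℂ) * Complex.cos (2^(2*m) * x) * (1 + B * S) =
    A * (Complex.cos (2^(2*m) * x) + B * (Complex.cos (2^(2*m) * x) * S)) := by intro S; ring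
  rw [this, Finset.mul_sum]
  congr 3
  refine Finset.sum_congr rfl fun k _ => ?_
  push_cast
  ring

theorem block_zero (c : LPCutoff) (m : ℕ) (hm : 8 ≤ m) (u : ℝ → ℂ)
    (hu : ∀ ξ : ℤ, (2:ℤ) ^ (m + 1) ≤ |(|ξ| - 2 ^ (2*m))| → fCoeff u ξ = 0)
    (j : ℤ) (hj : -1 ≤ j) (hj' : j ≤ 2 * m - 2 ∨ 2 * m + 2 ≤ j) : LPblock c j u = 0 := by
  have hbig : (4:ℝ) * 2^(m+1) ≤ 2^(2*m) := by
    have : (2:ℝ)^(2*m) = 2^(m+3) * 2^(m-3) := by rw [← pow_add]; congr 1; omega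
    rw [this, pow_add, pow_add]
    have h1 : (1:ℝ) ≤ 2^(m-3) := one_le_pow₀ (by norm_num)
    have h2 : (0:ℝ) < 2^m := by positivity
    nlinarith
  have hpos : (0:ℝ) < 2^(m+1) := by positivity
  have h8 : (2:ℝ) ≤ 2^(m+1) := by
    calc (2:ℝ) = 2^1 := by norm_num
      _ ≤ _ := pow_le_pow_right₀ (by norm_num) (by omega)
  have hu' : ∀ ξ : ℤ, (2:ℝ)^(m+1) ≤ |(|(ξ:ℝ)| - 2^(2*m))| → fCoeff u ξ = 0 := by
    intro ξ h
    apply hu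
    exact_mod_cast h
  funext x
  unfold LPblock
  split_ifs with h
  · have : ∀ ξ : ℤ, (c.χ ξ : ℂ) * fCoeff u ξ * Complex.exp (Complex.I * x * ξ) = 0 := by
      intro ξ
      by_cases hξ : 4/3 ≤ |(ξ:ℝ)|
      · simp [chi_zero c hξ]
      · rw [hu' ξ]
        · simp
        · rw [abs_sub_comm]
          refine le_trans ?_ (le_abs_self _)
          linarith
    simp [this]
  · have : ∀ ξ : ℤ, (c.phi ((2:ℝ) ^ (-j) * ξ) : ℂ) * fCoeff u ξ *
        Complex.exp (Complex.I * x * ξ) = 0 := by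
      intro ξ
      have hjp : (0:ℝ) < 2^j := by positivity
      have habs : |(2:ℝ) ^ (-j) * ξ| = |(ξ:ℝ)| / 2^j := by
        rw [abs_mul, abs_of_pos (by positivity), zpow_neg, inv_mul_eq_div]
      by_cases h1 : 8/3 ≤ |(2:ℝ) ^ (-j) * ξ|
      · rw [phi_zero_high c h1]; simp
      by_cases h2 : |(2:ℝ) ^ (-j) * ξ| ≤ 3/4
      · rw [phi_zero_low c h2]; simp
      rw [hu' ξ]
      · simp
      rw [habs] at h1 h2
      push Not at h1 h2
      rw [div_lt_iff₀ hjp] at h1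
      rw [lt_div_iff₀ hjp] at h2
      rcases hj' with hj' | hj'
      · have : (2:ℝ)^j ≤ 2^(2*m) / 4 := by
          calc (2:ℝ)^j ≤ 2^(((2*m : ℕ):ℤ) - 2) := zpow_le_zpow_right₀ (by norm_num) (by push_cast; omega)
            _ = _ := by rw [zpow_sub₀ (by norm_num), zpow_natCast]; norm_num
        rw [abs_sub_comm]
        refine le_trans ?_ (le_abs_self _)
        linarith
      · have : (2:ℝ)^(2*m) * 4 ≤ 2^j := by
          calc (2:ℝ)^(2*m) * 4 = 2^(((2*m : ℕ):ℤ) + 2) := by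
                rw [zpow_add₀ (by norm_num), zpow_natCast]; norm_num
            _ ≤ _ := zpow_le_zpow_right₀ (by norm_num) (by push_cast; omega)
        refine le_trans ?_ (le_abs_self _)
        linarith
    simp only [this, tsum_zero, mul_zero, Pi.zero_apply]

/-- For sufficiently large `n ∈ 16ℕ`, the Fourier coefficients of `u_{0,n}` vanish for
`||ξ| - 2^n| ≥ 2^{n/2+1}`; consequently `Δ_j u_{0,n} = 0` for `j ≥ -1`,
`j ∉ {n-1, n, n+1}`. -/
theorem u0CH_spectral_support (c : LPCutoff) :
    ∃ N : ℕ, ∀ n : ℕ, 16 ∣ n → N ≤ n →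
      (∀ ξ : ℤ, (2:ℤ) ^ (n / 2 + 1) ≤ |(|ξ| - 2 ^ n)| → fCoeff (toC (u0CH c n)) ξ = 0) ∧
      (∀ j : ℤ, -1 ≤ j → j ∉ ({(n:ℤ) - 1, (n:ℤ), (n:ℤ) + 1} : Set ℤ) →
        LPblock c j (toC (u0CH c n)) = 0) := by
  refine ⟨16, fun n hn hN => ?_⟩
  obtain ⟨m, rfl⟩ : ∃ m, n = 2 * m := ⟨n / 2, by omega⟩
  have h2 : 2 * m / 2 = m := by omega
  rw [h2]
  refine ⟨coeff_zero c m, fun j hj hj' => ?_⟩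
  refine block_zero c m (by omega) _ (coeff_zero c m) j hj ?_
  simp only [Set.mem_insert_iff, Set.mem_singleton_iff, not_or] at hj'
  push_cast at hj'
  omega
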